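/- arXiv:1310.6704 — 4 statements merged into one kernel-verified Lean document; each statement's English description precedes it below -/
import Mathlib

section
/- For every nonempty subset C of V and every designated agent i ∈ C, OPT(C) equals the maximum, over all feasible coalitions C' ⊆ C with i ∈ C', of v(C') plus the sum, over the connected components D of the subgraph of G induced on C \ C', of OPT(D). (This is the one-step validity of the hierarchical DP recurrence, Equation 2 of the paper, with i playing the role of the lowest-order agent of C.) -/
/-- A coalition `C` is feasible in the synergy graph `G` if it is nonempty and the
subgraph of `G` induced on `C` is connected. -/
def Feasible {V : Type*} (G : SimpleGraph V) (C : Finset V) : Prop :=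
  C.Nonempty ∧ (G.induce (C : Set V)).Connected

/-- `π` is a partition of `C` into feasible coalitions. -/
def IsFeasiblePartition {V : Type*} [DecidableEq V] (G : SimpleGraph V)
    (π : Finset (Finset V)) (C : Finset V) : Prop :=
  (∀ D ∈ π, Feasible G D) ∧ (π : Set (Finset V)).PairwiseDisjoint id ∧ π.biUnion id = C

/-- `OPT G v C` is the maximum, over all partitions of `C` into feasible coalitions,
of the sum of `v` over the parts (with `OPT G v ∅ = 0`, via the empty partition). -/
noncomputable def OPT {V : Type*} [DecidableEq V] (G : SimpleGraph V)
    (v : Finset V → ℝ) (C : Finset V) : ℝ :=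
  sSup {x : ℝ | ∃ π : Finset (Finset V), IsFeasiblePartition G π C ∧ x = ∑ D ∈ π, v D}

open Classical in
/-- The connected components of the subgraph of `G` induced on `C`, i.e. the maximal
feasible subsets of `C`. -/
noncomputable def comps {V : Type*} [DecidableEq V] (G : SimpleGraph V)
    (C : Finset V) : Finset (Finset V) :=
  C.powerset.filter fun D => Feasible G D ∧
    ∀ D' ∈ C.powerset, D ⊆ D' → Feasible G D' → D' = D


section Helpers

variable {V : Type*} [DecidableEq V]

theorem feasible_union {G : SimpleGraph V} {A B : Finset V} (hA : Feasible G A)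
    (hB : Feasible G B) (h : (A ∩ B).Nonempty) : Feasible G (A ∪ B) := by
  refine ⟨hA.1.mono Finset.subset_union_left, ?_⟩
  have := SimpleGraph.induce_union_connected (G := G) (s := (A : Set V)) (t := (B : Set V))
    hA.2.preconnected hB.2.preconnected (by exact_mod_cast h)
  rw [Finset.coe_union]
  exact this

theorem feasible_singleton (G : SimpleGraph V) (a : V) : Feasible G {a} := by
  refine ⟨Finset.singleton_nonempty a, ?_⟩
  rw [Finset.coe_singleton]
  have : Nonempty ({a} : Set V) := ⟨⟨a, rfl⟩⟩
  have : Subsingleton ({a} : Set V) := inferInstance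
  exact { preconnected := SimpleGraph.Preconnected.of_subsingleton }

theorem mem_comps {G : SimpleGraph V} {C D : Finset V} : D ∈ comps G C ↔
    D ⊆ C ∧ Feasible G D ∧ ∀ D' ⊆ C, D ⊆ D' → Feasible G D' → D' = D := by
  simp [comps]

theorem exists_comp {G : SimpleGraph V} {C D : Finset V} (hD : Feasible G D) (hDC : D ⊆ C) :
    ∃ E ∈ comps G C, D ⊆ E := by
  classical
  obtain ⟨E, hE, hmax⟩ := Finset.exists_max_image
    (C.powerset.filter fun E => D ⊆ E ∧ Feasible G E) Finset.card
    ⟨D, by simp [hD, hDC]⟩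
  simp only [Finset.mem_filter, Finset.mem_powerset] at hE hmax
  refine ⟨E, mem_comps.2 ⟨hE.1, hE.2.2, fun D' h1 h2 h3 => ?_⟩, hE.2.1⟩
  exact (Finset.eq_of_subset_of_card_le h2 (hmax D' ⟨h1, hE.2.1.trans h2, h3⟩)).symm

theorem comps_eq {G : SimpleGraph V} {C D E : Finset V} (hD : D ∈ comps G C)
    (hE : E ∈ comps G C) {a : V} (ha : a ∈ D) (hb : a ∈ E) : D = E := by
  rw [mem_comps] at hD hE
  have hU := feasible_union hD.2.1 hE.2.1 ⟨a, Finset.mem_inter.2 ⟨ha, hb⟩⟩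
  have hs := Finset.union_subset hD.1 hE.1
  rw [← hD.2.2 _ hs Finset.subset_union_left hU]
  exact hE.2.2 _ hs Finset.subset_union_right hU

theorem part_eq {G : SimpleGraph V} {π : Finset (Finset V)} {C D E : Finset V}
    (h : IsFeasiblePartition G π C) (hD : D ∈ π)
    (hE : E ∈ π) {a : V} (ha : a ∈ D) (hb : a ∈ E) : D = E := by
  by_contra hne
  exact Finset.disjoint_left.1 (h.2.1 hD hE hne) ha hb

theorem mk_part {G : SimpleGraph V} {π : Finset (Finset V)} {C : Finset V}
    (h1 : ∀ D ∈ π, Feasible G D)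
    (h2 : ∀ D ∈ π, ∀ E ∈ π, ∀ a, a ∈ D → a ∈ E → D = E)
    (h3 : ∀ D ∈ π, D ⊆ C) (h4 : ∀ a ∈ C, ∃ D ∈ π, a ∈ D) : IsFeasiblePartition G π C := by
  refine ⟨h1, fun D hD E hE hne => ?_, ?_⟩
  · exact Finset.disjoint_left.2 fun a ha hb => hne (h2 D hD E hE a ha hb)
  · ext a
    simp only [Finset.mem_biUnion, id]
    exact ⟨fun ⟨D, hD, ha⟩ => h3 D hD ha, h4 a⟩

theorem part_subset {G : SimpleGraph V} {π : Finset (Finset V)} {C D : Finset V}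
    (h : IsFeasiblePartition G π C) (hD : D ∈ π) : D ⊆ C := by
  rw [← h.2.2]
  exact Finset.subset_biUnion_of_mem id hD

theorem part_cover {G : SimpleGraph V} {π : Finset (Finset V)} {C : Finset V}
    (h : IsFeasiblePartition G π C) {a : V} (ha : a ∈ C) : ∃ D ∈ π, a ∈ D := by
  rw [← h.2.2] at ha
  simpa using ha

theorem parts_finite (G : SimpleGraph V) (v : Finset V → ℝ) (C : Finset V) :
    {x : ℝ | ∃ π : Finset (Finset V), IsFeasiblePartition G π C ∧ x = ∑ D ∈ π, v D}.Finite := by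
  refine ((C.powerset.powerset.image fun π => ∑ D ∈ π, v D).finite_toSet).subset ?_
  rintro x ⟨π, hπ, rfl⟩
  refine Finset.mem_coe.2 (Finset.mem_image.2 ⟨π, ?_, rfl⟩)
  exact Finset.mem_powerset.2 fun D hD => Finset.mem_powerset.2 (part_subset hπ hD)

theorem le_OPT {G : SimpleGraph V} (v : Finset V → ℝ) {π : Finset (Finset V)} {C : Finset V}
    (h : IsFeasiblePartition G π C) : ∑ D ∈ π, v D ≤ OPT G v C :=
  le_csSup (parts_finite G v C).bddAbove ⟨π, h, rfl⟩

theorem exists_OPT (G : SimpleGraph V) (v : Finset V → ℝ) (C : Finset V) :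
    ∃ π, IsFeasiblePartition G π C ∧ OPT G v C = ∑ D ∈ π, v D := by
  refine Set.Nonempty.csSup_mem (s := {x : ℝ | ∃ π : Finset (Finset V),
    IsFeasiblePartition G π C ∧ x = ∑ D ∈ π, v D}) ?_ (parts_finite G v C)
  refine ⟨_, C.image (fun a => {a}), mk_part ?_ ?_ ?_ ?_, rfl⟩
  · simp only [Finset.mem_image]
    rintro _ ⟨a, _, rfl⟩
    exact feasible_singleton G a
  · simp only [Finset.mem_image]
    rintro _ ⟨a, _, rfl⟩ _ ⟨b, _, rfl⟩ c h1 h2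
    rw [← Finset.mem_singleton.1 h1, ← Finset.mem_singleton.1 h2]
  · simp only [Finset.mem_image]
    rintro _ ⟨a, ha, rfl⟩
    simpa using ha
  · intro a ha
    exact ⟨{a}, Finset.mem_image_of_mem _ ha, Finset.mem_singleton_self a⟩

theorem part_sum_le (G : SimpleGraph V) (v : Finset V → ℝ) {C : Finset V}
    {π : Finset (Finset V)} (h : IsFeasiblePartition G π C) :
    ∑ D ∈ π, v D ≤ ∑ E ∈ comps G C, OPT G v E := by
  have key : π = (comps G C).biUnion fun E => π.filter (· ⊆ E) := by
    ext D
    simp only [Finset.mem_biUnion, Finset.mem_filter]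
    refine ⟨fun hD => ?_, fun ⟨_, _, hD, _⟩ => hD⟩
    obtain ⟨E, hE, hDE⟩ := exists_comp (h.1 D hD) (part_subset h hD)
    exact ⟨E, hE, hD, hDE⟩
  rw [key, Finset.sum_biUnion]
  · refine Finset.sum_le_sum fun E hE => le_OPT v (mk_part ?_ ?_ ?_ ?_)
    · intro D hD
      exact h.1 D (Finset.mem_filter.1 hD).1
    · intro D hD D' hD' a ha hb
      exact part_eq h (Finset.mem_filter.1 hD).1 (Finset.mem_filter.1 hD').1 ha hb
    · intro D hD
      exact (Finset.mem_filter.1 hD).2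
    · intro a ha
      obtain ⟨D, hD, haD⟩ := part_cover h ((mem_comps.1 hE).1 ha)
      obtain ⟨E', hE', hDE⟩ := exists_comp (h.1 D hD) (part_subset h hD)
      have : E' = E := comps_eq hE' hE (hDE haD) ha
      subst this
      exact ⟨D, Finset.mem_filter.2 ⟨hD, hDE⟩, haD⟩
  · intro E hE E' hE' hne
    refine Finset.disjoint_left.2 fun D hD hD' => hne ?_
    rw [Finset.mem_filter] at hD hD'
    obtain ⟨a, ha⟩ := (h.1 D hD.1).1
    exact comps_eq hE hE' (hD.2 ha) (hD'.2 ha)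

theorem exists_glue (G : SimpleGraph V) (v : Finset V → ℝ) (C : Finset V) :
    ∃ π, IsFeasiblePartition G π C ∧ ∑ E ∈ comps G C, OPT G v E = ∑ D ∈ π, v D := by
  choose p hp hs using exists_OPT G v
  refine ⟨(comps G C).biUnion p, mk_part ?_ ?_ ?_ ?_, ?_⟩
  · intro D hD
    obtain ⟨E, hE, hD⟩ := Finset.mem_biUnion.1 hD
    exact (hp E).1 D hD
  · intro D hD D' hD' a ha hb
    obtain ⟨E, hE, hD⟩ := Finset.mem_biUnion.1 hD
    obtain ⟨E', hE', hD'⟩ := Finset.mem_biUnion.1 hD'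
    have : E = E' := comps_eq hE hE' (part_subset (hp E) hD ha) (part_subset (hp E') hD' hb)
    subst this
    exact part_eq (hp E) hD hD' ha hb
  · intro D hD
    obtain ⟨E, hE, hD⟩ := Finset.mem_biUnion.1 hD
    exact (part_subset (hp E) hD).trans (mem_comps.1 hE).1
  · intro a ha
    obtain ⟨E, hE, haE⟩ := exists_comp (feasible_singleton G a)
      (Finset.singleton_subset_iff.2 ha)
    obtain ⟨D, hD, haD⟩ := part_cover (hp E) (Finset.singleton_subset_iff.1 haE)
    exact ⟨D, Finset.mem_biUnion.2 ⟨E, hE, hD⟩, haD⟩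
  · rw [Finset.sum_biUnion]
    · exact Finset.sum_congr rfl fun E _ => hs E
    · intro E hE E' hE' hne
      refine Finset.disjoint_left.2 fun D hD hD' => hne ?_
      obtain ⟨a, ha⟩ := ((hp E).1 D hD).1
      exact comps_eq hE hE' (part_subset (hp E) hD ha) (part_subset (hp E') hD' ha)

theorem rhs_le (G : SimpleGraph V) (v : Finset V → ℝ) {C C' : Finset V} (hs : C' ⊆ C)
    (hf : Feasible G C') : v C' + ∑ D ∈ comps G (C \ C'), OPT G v D ≤ OPT G v C := by
  obtain ⟨π, hπ, h⟩ := exists_glue G v (C \ C')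
  have hd : ∀ D ∈ π, ∀ a ∈ D, a ∉ C' := fun D hD a ha =>
    (Finset.mem_sdiff.1 (part_subset hπ hD ha)).2
  have hn : C' ∉ π := fun hm => by
    obtain ⟨a, ha⟩ := hf.1
    exact hd _ hm a ha ha
  rw [h, ← Finset.sum_insert hn]
  refine le_OPT v (mk_part ?_ ?_ ?_ ?_)
  · intro D hD
    rcases Finset.mem_insert.1 hD with rfl | hD
    · exact hf
    · exact hπ.1 D hD
  · intro D hD E hE a ha hb
    rcases Finset.mem_insert.1 hD with rfl | hD1 <;> rcases Finset.mem_insert.1 hE with rfl | hE1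
    · rfl
    · exact absurd ha (hd E hE1 a hb)
    · exact absurd hb (hd D hD1 a ha)
    · exact part_eq hπ hD1 hE1 ha hb
  · intro D hD
    rcases Finset.mem_insert.1 hD with rfl | hD
    · exact hs
    · exact (part_subset hπ hD).trans Finset.sdiff_subset
  · intro a ha
    by_cases hc : a ∈ C'
    · exact ⟨C', Finset.mem_insert_self _ _, hc⟩
    · obtain ⟨D, hD, haD⟩ := part_cover hπ (Finset.mem_sdiff.2 ⟨ha, hc⟩)
      exact ⟨D, Finset.mem_insert_of_mem hD, haD⟩

theorem exists_rhs_ge (G : SimpleGraph V) (v : Finset V → ℝ) {C : Finset V} {i : V}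
    (hi : i ∈ C) : ∃ C' ⊆ C, i ∈ C' ∧ Feasible G C' ∧
      OPT G v C ≤ v C' + ∑ D ∈ comps G (C \ C'), OPT G v D := by
  obtain ⟨π, hπ, h⟩ := exists_OPT G v C
  obtain ⟨C', hC', hiC⟩ := part_cover hπ hi
  refine ⟨C', part_subset hπ hC', hiC, hπ.1 _ hC', ?_⟩
  rw [h, ← Finset.add_sum_erase π v hC']
  refine add_le_add_right (part_sum_le G v (mk_part ?_ ?_ ?_ ?_)) _
  · intro D hD
    exact hπ.1 D (Finset.mem_of_mem_erase hD)
  · intro D hD E hE a ha hb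
    exact part_eq hπ (Finset.mem_of_mem_erase hD) (Finset.mem_of_mem_erase hE) ha hb
  · intro D hD a ha
    refine Finset.mem_sdiff.2 ⟨part_subset hπ (Finset.mem_of_mem_erase hD) ha, fun hc => ?_⟩
    exact (Finset.mem_erase.1 hD).1 (part_eq hπ (Finset.mem_of_mem_erase hD) hC' ha hc)
  · intro a ha
    rw [Finset.mem_sdiff] at ha
    obtain ⟨D, hD, haD⟩ := part_cover hπ ha.1
    refine ⟨D, Finset.mem_erase.2 ⟨?_, hD⟩, haD⟩
    rintro rfl
    exact ha.2 haD

end Helpers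

theorem opt_eq_max_over_coalitions_containing_agent {V : Type*} [Fintype V] [DecidableEq V]
    (G : SimpleGraph V) (v : Finset V → ℝ) (C : Finset V) (hC : C.Nonempty)
    (i : V) (hi : i ∈ C) :
    OPT G v C =
      sSup {x : ℝ | ∃ C' : Finset V, C' ⊆ C ∧ i ∈ C' ∧ Feasible G C' ∧
        x = v C' + ∑ D ∈ comps G (C \ C'), OPT G v D} := by
  symm
  obtain ⟨C', h1, h2, h3, h4⟩ := exists_rhs_ge G v hi
  refine IsGreatest.csSup_eq ⟨⟨C', h1, h2, h3, ?_⟩, ?_⟩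
  · exact le_antisymm h4 (rhs_le G v h1 h3)
  · rintro x ⟨D, hD, _, hf, rfl⟩
    exact rhs_le G v hD hf
end

section
/- For every feasible coalition C (i.e., C nonempty and inducing a connected subgraph of G), OPT(C) equals the maximum of v(C) and the maximum, over all partitions of C into two feasible coalitions C₁ and C₂, of OPT(C₁) + OPT(C₂) (the latter maximum being taken over a possibly empty collection, in which case OPT(C) = v(C)). (This is the graph-restricted two-way-split DP recurrence, Equation 1 restricted to feasible coalitions, which underlies the DyCE algorithm.) -/
theorem opt_set_finite {V : Type*} [Fintype V] [DecidableEq V] (G : SimpleGraph V)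
    (v : Finset V → ℝ) (C : Finset V) :
    {x : ℝ | ∃ π : Finset (Finset V), IsFeasiblePartition G π C ∧ x = ∑ D ∈ π, v D}.Finite := by
  refine (Set.finite_range (fun π : Finset (Finset V) => ∑ D ∈ π, v D)).subset ?_
  rintro x ⟨π, _, rfl⟩
  exact ⟨π, rfl⟩

theorem le_opt {V : Type*} [Fintype V] [DecidableEq V] (G : SimpleGraph V)
    (v : Finset V → ℝ) (C : Finset V) (π : Finset (Finset V))
    (h : IsFeasiblePartition G π C) : ∑ D ∈ π, v D ≤ OPT G v C :=
  le_csSup (opt_set_finite G v C).bddAbove ⟨π, h, rfl⟩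

theorem singleton_partition {V : Type*} [DecidableEq V] (G : SimpleGraph V)
    (C : Finset V) (hC : Feasible G C) : IsFeasiblePartition G {C} C := by
  refine ⟨by simpa using hC, by simp, by simp⟩

theorem opt_attained {V : Type*} [Fintype V] [DecidableEq V] (G : SimpleGraph V)
    (v : Finset V → ℝ) (C : Finset V) (hC : Feasible G C) :
    ∃ π, IsFeasiblePartition G π C ∧ OPT G v C = ∑ D ∈ π, v D :=
  Set.Nonempty.csSup_mem
    (s := {x : ℝ | ∃ π : Finset (Finset V), IsFeasiblePartition G π C ∧ x = ∑ D ∈ π, v D})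
    ⟨_, {C}, singleton_partition G C hC, rfl⟩ (opt_set_finite G v C)

theorem union_partition {V : Type*} [DecidableEq V] (G : SimpleGraph V)
    (C₁ C₂ : Finset V) (hd : Disjoint C₁ C₂) (π₁ π₂ : Finset (Finset V))
    (h₁ : IsFeasiblePartition G π₁ C₁) (h₂ : IsFeasiblePartition G π₂ C₂) :
    Disjoint π₁ π₂ ∧ IsFeasiblePartition G (π₁ ∪ π₂) (C₁ ∪ C₂) := by
  obtain ⟨f₁, d₁, rfl⟩ := h₁
  obtain ⟨f₂, d₂, rfl⟩ := h₂
  have key : ∀ A ∈ π₁, ∀ B ∈ π₂, Disjoint A B := fun A hA B hB =>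
    hd.mono (Finset.subset_biUnion_of_mem id hA) (Finset.subset_biUnion_of_mem id hB)
  refine ⟨?_, ?_, ?_, ?_⟩
  · rw [Finset.disjoint_left]
    intro A hA hB
    have h := key A hA A hB
    rw [disjoint_self] at h
    exact (f₁ A hA).1.ne_empty h
  · intro D hD
    rcases Finset.mem_union.1 hD with h | h
    · exact f₁ D h
    · exact f₂ D h
  · intro A hA B hB hne
    simp only [Finset.coe_union, Set.mem_union, Finset.mem_coe] at hA hB
    rcases hA with hA | hA <;> rcases hB with hB | hB
    · exact d₁ hA hB hne
    · exact key A hA B hB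
    · exact (key B hB A hA).symm
    · exact d₂ hA hB hne
  · rw [Finset.union_biUnion]

/-- A partition of a connected set into at least two parts has a removable part. -/
theorem exists_removable {V : Type*} [DecidableEq V] (G : SimpleGraph V)
    (C : Finset V) (hC : Feasible G C) (π : Finset (Finset V))
    (h : IsFeasiblePartition G π C) (h2 : 2 ≤ π.card) :
    ∃ D ∈ π, Feasible G ((π.erase D).biUnion id) := by
  classical
  obtain ⟨f, d, rfl⟩ := h
  let S := π.powerset.filter fun σ => σ ≠ π ∧ Feasible G (σ.biUnion id)
  have hS : S.Nonempty := by
    obtain ⟨D, hD⟩ : π.Nonempty := Finset.card_pos.1 (by omega)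
    refine ⟨{D}, ?_⟩
    simp only [S, Finset.mem_filter, Finset.mem_powerset, Finset.singleton_subset_iff,
      Finset.singleton_biUnion, id]
    refine ⟨hD, ?_, f D hD⟩
    rintro rfl
    simp at h2
  obtain ⟨σ, hσ, hmax⟩ := S.exists_max_image Finset.card hS
  simp only [S, Finset.mem_filter, Finset.mem_powerset] at hσ hmax
  obtain ⟨hsub, hne, hf⟩ := hσ
  obtain ⟨E, hE, hEσ⟩ := Finset.exists_of_ssubset (hsub.ssubset_of_ne hne)
  obtain ⟨a, ha⟩ := hf.1
  obtain ⟨b, hb⟩ := (f E hE).1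
  have haC : a ∈ π.biUnion id := Finset.biUnion_subset_biUnion_of_subset_left _ hsub ha
  have hbC : b ∈ π.biUnion id := Finset.mem_biUnion.2 ⟨E, hE, hb⟩
  have hbσ : b ∉ σ.biUnion id := by
    intro hb'
    obtain ⟨F, hF, hbF⟩ := Finset.mem_biUnion.1 hb'
    have hEF : E ≠ F := by
      rintro rfl
      exact hEσ hF
    exact Finset.disjoint_left.1 (d hE (hsub hF) hEF) hb hbF
  obtain ⟨p⟩ := hC.2.preconnected ⟨a, haC⟩ ⟨b, hbC⟩
  obtain ⟨e, -, he1, he2⟩ := p.exists_boundary_dart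
    {x | (x : V) ∈ σ.biUnion id} ha hbσ
  have hadj : G.Adj (e.fst : V) (e.snd : V) := e.adj
  obtain ⟨D, hD, heD⟩ := Finset.mem_biUnion.1 (Finset.mem_coe.1 e.snd.2)
  have hDσ : D ∉ σ := fun hh => he2 (Finset.mem_biUnion.2 ⟨D, hh, heD⟩)
  have hfeas : Feasible G ((insert D σ).biUnion id) := by
    rw [Finset.biUnion_insert, Finset.union_comm]
    refine ⟨⟨a, Finset.mem_union_left _ ha⟩, ?_⟩
    rw [Finset.coe_union]
    exact SimpleGraph.connected_induce_union hf.2.preconnected (f D hD).2.preconnected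
      he1 heD hadj
  have heq : insert D σ = π := by
    by_contra hne'
    have := hmax (insert D σ) ⟨Finset.insert_subset hD hsub, hne', hfeas⟩
    rw [Finset.card_insert_of_notMem hDσ] at this
    omega
  refine ⟨D, hD, ?_⟩
  rw [← heq, Finset.erase_insert hDσ]
  exact hf

theorem opt_eq_max_over_two_way_splits {V : Type*} [Fintype V] [DecidableEq V]
    (G : SimpleGraph V) (v : Finset V → ℝ) (C : Finset V) (hC : Feasible G C) :
    OPT G v C =
      sSup (insert (v C)
        {x : ℝ | ∃ C₁ C₂ : Finset V, Feasible G C₁ ∧ Feasible G C₂ ∧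
          Disjoint C₁ C₂ ∧ C₁ ∪ C₂ = C ∧ x = OPT G v C₁ + OPT G v C₂}) := by
  have hub : ∀ x ∈ insert (v C)
        {x : ℝ | ∃ C₁ C₂ : Finset V, Feasible G C₁ ∧ Feasible G C₂ ∧
          Disjoint C₁ C₂ ∧ C₁ ∪ C₂ = C ∧ x = OPT G v C₁ + OPT G v C₂}, x ≤ OPT G v C := by
    rintro x (rfl | ⟨C₁, C₂, h₁, h₂, hd, rfl, rfl⟩)
    · simpa using le_opt G v C {C} (singleton_partition G C hC)
    · obtain ⟨π₁, p₁, e₁⟩ := opt_attained G v C₁ h₁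
      obtain ⟨π₂, p₂, e₂⟩ := opt_attained G v C₂ h₂
      obtain ⟨hdd, hp⟩ := union_partition G C₁ C₂ hd π₁ π₂ p₁ p₂
      rw [e₁, e₂, ← Finset.sum_union hdd]
      exact le_opt G v _ _ hp
  have hb : BddAbove (insert (v C)
        {x : ℝ | ∃ C₁ C₂ : Finset V, Feasible G C₁ ∧ Feasible G C₂ ∧
          Disjoint C₁ C₂ ∧ C₁ ∪ C₂ = C ∧ x = OPT G v C₁ + OPT G v C₂}) := ⟨_, hub⟩
  apply le_antisymm
  · obtain ⟨π, hπ, e⟩ := opt_attained G v C hC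
    rw [e]
    by_cases h2 : 2 ≤ π.card
    · obtain ⟨D, hD, hf⟩ := exists_removable G C hC π hπ h2
      obtain ⟨f, d, hu⟩ := hπ
      have hp : IsFeasiblePartition G (π.erase D) ((π.erase D).biUnion id) :=
        ⟨fun E hE => f E (Finset.mem_of_mem_erase hE),
          d.subset (by exact_mod_cast Finset.erase_subset D π), rfl⟩
      have h1 := le_opt G v _ _ hp
      have h3 := le_opt G v D {D} (singleton_partition G D (f D hD))
      rw [Finset.sum_singleton] at h3
      rw [← Finset.add_sum_erase π v hD]
      refine (add_le_add h3 h1).trans (le_csSup hb (Or.inr ⟨D, _, f D hD, hf, ?_, ?_, rfl⟩))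
      · rw [Finset.disjoint_biUnion_right]
        intro E hE
        exact d hD (Finset.mem_of_mem_erase hE) (Finset.ne_of_mem_erase hE).symm
      · rw [← hu]
        conv_rhs => rw [← Finset.insert_erase hD, Finset.biUnion_insert]
        rfl
    · obtain ⟨f, d, hu⟩ := hπ
      have hne : π.Nonempty := by
        rw [Finset.nonempty_iff_ne_empty]
        rintro rfl
        exact hC.1.ne_empty (by simpa using hu.symm)
      have hc := hne.card_pos
      obtain ⟨D, rfl⟩ := Finset.card_eq_one.1 (show π.card = 1 by omega)
      have hDC : D = C := by simpa using hu
      rw [Finset.sum_singleton, hDC]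
      exact le_csSup hb (Or.inl rfl)
  · exact csSup_le ⟨_, Or.inl rfl⟩ hub
end

section
/- Let G be a simple graph on a finite linearly ordered vertex set V such that every vertex other than the minimum of V has a neighbor in G that is strictly smaller than itself. Let π be a partition of V into parts each inducing a connected subgraph of G, and order the parts of π by their minimum elements. Then for every k with 1 ≤ k ≤ |π|, the union of the k parts with the smallest minima induces a connected subgraph of G. (This abstracts the key inductive step in the proof of Theorem 1: under a pseudotree-compatible ordering, the union of the coalitions of lowest order in any feasible coalition structure is connected.) -/
/-- Under an ordering in which every non-minimal vertex has a strictly smaller neighbor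
(a pseudotree-compatible ordering), for any partition of the vertices into connected
parts, the union of the `k` parts with the smallest minima is connected. -/
theorem union_of_lowest_order_parts_connected
    {V : Type*} [Fintype V] [DecidableEq V] [LinearOrder V] [Nonempty V]
    (G : SimpleGraph V)
    (hdown : ∀ x : V, x ≠ Finset.univ.min' Finset.univ_nonempty →
      ∃ y : V, G.Adj x y ∧ y < x)
    (π : Finset (Finset V))
    (hparts : ∀ P ∈ π, P.Nonempty ∧ (G.induce (P : Set V)).Connected)
    (hdisj : (π : Set (Finset V)).PairwiseDisjoint id)
    (hcover : π.biUnion id = Finset.univ)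
    (k : ℕ) (hk1 : 1 ≤ k) (hk2 : k ≤ π.card) :
    (G.induce
      ((((π.filter fun P => (π.filter fun Q => Q.min < P.min).card < k).biUnion id :
        Finset V) : Set V))).Connected := by
  set U : Set V := ((((π.filter fun P => (π.filter fun Q => Q.min < P.min).card < k).biUnion id :
        Finset V) : Set V)) with hUdef
  have hU : ∀ x, x ∈ U ↔ ∃ P ∈ π, (π.filter fun Q => Q.min < P.min).card < k ∧ x ∈ P := by
    intro x
    simp [hUdef, and_assoc]
  have hcov : ∀ x : V, ∃ P ∈ π, x ∈ P := by
    intro x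
    have hx : x ∈ π.biUnion id := by rw [hcover]; exact Finset.mem_univ x
    simpa using hx
  set m : V := Finset.univ.min' Finset.univ_nonempty with hm
  have hmle : ∀ x, m ≤ x := fun x => Finset.min'_le _ x (Finset.mem_univ x)
  have hmU : m ∈ U := by
    obtain ⟨P, hP, hmP⟩ := hcov m
    refine (hU m).2 ⟨P, hP, ?_, hmP⟩
    have h0 : (π.filter fun Q => Q.min < P.min) = ∅ := by
      apply Finset.filter_eq_empty_iff.2
      intro Q hQ hlt
      obtain ⟨q, hq⟩ := Finset.min_of_nonempty (hparts Q hQ).1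
      have h1 : P.min ≤ (m : WithTop V) := Finset.min_le hmP
      rw [hq] at hlt
      have h2 : (q : WithTop V) < (m : WithTop V) := lt_of_lt_of_le hlt h1
      exact absurd (WithTop.coe_lt_coe.1 h2) (not_lt.2 (hmle q))
    rw [h0]
    rw [Finset.card_empty]; exact hk1
  have key : ∀ x : V, ∀ hx : x ∈ U, (G.induce U).Reachable ⟨x, hx⟩ ⟨m, hmU⟩ := by
    intro x
    induction x using WellFoundedLT.induction with
    | ind x ih =>
      intro hx
      obtain ⟨P, hP, hcard, hxP⟩ := (hU x).1 hx
      have hPU : (P : Set V) ⊆ U := fun z hz => (hU z).2 ⟨P, hP, hcard, hz⟩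
      obtain ⟨p, hp⟩ := Finset.min_of_nonempty (hparts P hP).1
      have hpP : p ∈ P := Finset.mem_of_min hp
      have hpx : p ≤ x := Finset.min_le_of_eq hxP hp
      have h1 : (G.induce U).Reachable ⟨x, hx⟩ ⟨p, hPU hpP⟩ :=
        ((hparts P hP).2.preconnected ⟨x, hxP⟩ ⟨p, hpP⟩).map
          (SimpleGraph.induceHomOfLE G hPU).toHom
      by_cases hpm : p = m
      · subst hpm
        exact h1
      · obtain ⟨y, hadj, hyp⟩ := hdown p hpm
        obtain ⟨Q, hQ, hyQ⟩ := hcov y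
        have hQP : Q.min < P.min := by
          rw [hp]
          exact lt_of_le_of_lt (Finset.min_le hyQ) (WithTop.coe_lt_coe.2 hyp)
        have hyU : y ∈ U := by
          refine (hU y).2 ⟨Q, hQ, lt_of_le_of_lt (Finset.card_le_card ?_) hcard, hyQ⟩
          intro R hR
          rw [Finset.mem_filter] at hR ⊢
          exact ⟨hR.1, hR.2.trans hQP⟩
        have h2 : (G.induce U).Adj ⟨p, hPU hpP⟩ ⟨y, hyU⟩ := hadj
        exact (h1.trans h2.reachable).trans (ih y (lt_of_lt_of_le hyp hpx) hyU)
  have : Nonempty U := ⟨⟨m, hmU⟩⟩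
  exact ⟨fun a b => (key a.1 a.2).trans (key b.1 b.2).symm⟩
end

section
/- Let G be a simple graph on a finite vertex set, let C be a subset of vertices inducing a connected subgraph, and let π be a partition of C into at least two parts, each of which induces a connected subgraph of G. Then there exists a part P ∈ π such that C \ P induces a connected subgraph of G. (This splitting property is what makes the two-way-split DP recurrence over feasible coalitions complete: any feasible coalition structure of a connected set can be reached by repeatedly splitting into two feasible parts.) -/
/-- If a connected set `C` is partitioned into at least two connected parts, then some
part `P` can be removed so that `C \ P` is still connected. -/
theorem exists_removable_part
    {V : Type*} [Fintype V] [DecidableEq V] (G : SimpleGraph V) (C : Finset V)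
    (hC : (G.induce (C : Set V)).Connected)
    (π : Finset (Finset V))
    (hparts : ∀ P ∈ π, P.Nonempty ∧ (G.induce (P : Set V)).Connected)
    (hdisj : (π : Set (Finset V)).PairwiseDisjoint id)
    (hcover : π.biUnion id = C)
    (hcard : 2 ≤ π.card) :
    ∃ P ∈ π, (G.induce ((C \ P : Finset V) : Set V)).Connected := by
  classical
  -- the quotient graph on the parts
  let H : SimpleGraph π :=
    { Adj := fun P Q => P ≠ Q ∧ ∃ a ∈ P.1, ∃ b ∈ Q.1, G.Adj a b
      symm := ⟨fun P Q h => by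
        obtain ⟨h, a, ha, b, hb, hab⟩ := h
        exact ⟨h.symm, b, hb, a, ha, hab.symm⟩⟩
      loopless := ⟨fun P h => h.1 rfl⟩ }
  have huniq : ∀ P Q : π, ∀ a, a ∈ P.1 → a ∈ Q.1 → P = Q := by
    intro P Q a hP hQ
    by_contra hne
    have := hdisj P.2 Q.2 (fun h => hne (Subtype.ext h))
    exact Finset.disjoint_left.mp this hP hQ
  have hsub : ∀ P : π, P.1 ⊆ C := by
    intro P a ha
    rw [← hcover]
    exact Finset.mem_biUnion.mpr ⟨P.1, P.2, ha⟩
  have hmem : ∀ a ∈ C, ∃ P : π, a ∈ P.1 := by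
    intro a ha
    rw [← hcover] at ha
    obtain ⟨P, hP, haP⟩ := Finset.mem_biUnion.mp ha
    exact ⟨⟨P, hP⟩, haP⟩
  have hup : ∀ a b : (C : Set V), ∀ w : (G.induce (C : Set V)).Walk a b,
      ∀ P Q : π, a.1 ∈ P.1 → b.1 ∈ Q.1 → H.Reachable P Q := by
    intro a b w
    induction w with
    | nil =>
      intro P Q hP hQ
      rw [huniq P Q _ hP hQ]
    | @cons a c b hac w ih =>
      intro P Q hP hQ
      obtain ⟨R, hR⟩ := hmem c.1 c.2
      refine SimpleGraph.Reachable.trans ?_ (ih R Q hR hQ)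
      by_cases hPR : P = R
      · rw [hPR]
      · exact SimpleGraph.Adj.reachable (G := H) ⟨hPR, a.1, hP, c.1, hR, hac⟩
  have : Nontrivial π := by
    rw [← Fintype.one_lt_card_iff_nontrivial, Fintype.card_coe]
    omega
  have hH : H.Connected := by
    refine ⟨?_⟩
    intro P Q
    obtain ⟨a, ha⟩ := (hparts P.1 P.2).1
    obtain ⟨b, hb⟩ := (hparts Q.1 Q.2).1
    obtain ⟨w⟩ := hC.preconnected ⟨a, hsub P ha⟩ ⟨b, hsub Q hb⟩
    exact hup _ _ w P Q ha hb
  obtain ⟨P, hP⟩ := hH.exists_connected_induce_compl_singleton_of_finite_nontrivial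
  refine ⟨P.1, P.2, ?_⟩
  have hsub' : ∀ Q : π, Q ≠ P → ∀ a ∈ Q.1, a ∈ ((C \ P.1 : Finset V) : Set V) := by
    intro Q hQ a ha
    simp only [Finset.coe_sdiff, Set.mem_diff, Finset.mem_coe]
    exact ⟨hsub Q ha, fun h => hQ (huniq Q P a ha h)⟩
  have hin : ∀ Q : π, Q ≠ P → ∀ a b : ((C \ P.1 : Finset V) : Set V), a.1 ∈ Q.1 → b.1 ∈ Q.1 →
      (G.induce ((C \ P.1 : Finset V) : Set V)).Reachable a b := by
    intro Q hQ a b ha hb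
    have h := (hparts Q.1 Q.2).2.preconnected ⟨a.1, ha⟩ ⟨b.1, hb⟩
    exact h.map (SimpleGraph.induceHomOfLE G (fun x hx => hsub' Q hQ x hx)).toHom
  have hdown : ∀ Q R : ({P}ᶜ : Set π), ∀ w : (H.induce ({P}ᶜ : Set π)).Walk Q R,
      ∀ a b : ((C \ P.1 : Finset V) : Set V), a.1 ∈ Q.1.1 → b.1 ∈ R.1.1 →
      (G.induce ((C \ P.1 : Finset V) : Set V)).Reachable a b := by
    intro Q R w
    induction w with
    | @nil Q =>
      intro a b ha hb
      exact hin Q.1 Q.2 a b ha hb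
    | @cons Q S R hQS w ih =>
      intro a b ha hb
      obtain ⟨-, c, hc, d, hd, hcd⟩ := hQS
      have hc' := hsub' Q.1 Q.2 c hc
      have hd' := hsub' S.1 S.2 d hd
      have h1 := hin Q.1 Q.2 a ⟨c, hc'⟩ ha hc
      have h2 : (G.induce ((C \ P.1 : Finset V) : Set V)).Adj ⟨c, hc'⟩ ⟨d, hd'⟩ := hcd
      exact h1.trans (h2.reachable.trans (ih ⟨d, hd'⟩ b hd hb))
  have hne : Nonempty ((C \ P.1 : Finset V) : Set V) := by
    obtain ⟨Q⟩ := hP.nonempty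
    obtain ⟨a, ha⟩ := (hparts Q.1.1 Q.1.2).1
    exact ⟨⟨a, hsub' Q.1 Q.2 a ha⟩⟩
  have hpart : ∀ a : ((C \ P.1 : Finset V) : Set V), ∃ Q : ({P}ᶜ : Set π), a.1 ∈ Q.1.1 := by
    rintro ⟨a, ha⟩
    have ha' := Finset.mem_sdiff.mp (Finset.mem_coe.mp ha)
    obtain ⟨Q, hQ⟩ := hmem a ha'.1
    exact ⟨⟨Q, fun h => ha'.2 (by rw [Set.mem_singleton_iff] at h; exact h ▸ hQ)⟩, hQ⟩
  refine ⟨?_⟩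
  intro a b
  obtain ⟨Q, hQ⟩ := hpart a
  obtain ⟨R, hR⟩ := hpart b
  obtain ⟨w⟩ := hP.preconnected Q R
  exact hdown Q R w a b hQ hR
end
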